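/- arXiv:1309.2000 — 3 statements merged into one kernel-verified Lean document; each statement's English description precedes it below -/
import Mathlib

section
/- Fix 0 < c < 1 and an integer k ≥ 2, and let G_n ∈ G(n, c/n). Let T_k(G_n) denote the number of connected components of G_n that are trees with exactly k vertices. Then E[T_k(G_n)] = n · k^{k−2} · (c^{k−1}/k!) · e^{−kc} · (1+o(1)) as n → ∞. -/
open scoped Classical BigOperators
open Filter Topology

noncomputable section

namespace MetricDimPaper

/-- `R` is a resolving set of `G`: every pair of distinct vertices is distinguished by its
vector of (extended, possibly infinite) distances to the vertices of `R`. -/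
def Resolves {V : Type*} (G : SimpleGraph V) (R : Set V) : Prop :=
  ∀ u v : V, u ≠ v → ∃ w ∈ R, G.edist u w ≠ G.edist v w

/-- The metric dimension of a graph: the least cardinality of a resolving set, with the
convention that a single isolated vertex has metric dimension 1. -/
def metricDim {V : Type*} (G : SimpleGraph V) : ℕ :=
  if Nat.card V = 1 then 1
  else sInf {m : ℕ | ∃ R : Set V, R.ncard = m ∧ Resolves G R}

/-- A tree: a connected acyclic graph. -/
def IsTree {V : Type*} (G : SimpleGraph V) : Prop := G.Connected ∧ G.IsAcyclic

/-- degree of a vertex (as `Nat.card` of the neighbor set). -/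
def ndeg {V : Type*} (G : SimpleGraph V) (v : V) : ℕ := (G.neighborSet v).ncard

/-- metric dimension as a real number -/
def betaR {n : ℕ} (G : SimpleGraph (Fin n)) : ℝ := (metricDim G : ℝ)

def treeSet (n : ℕ) : Set (SimpleGraph (Fin n)) := {G | IsTree G}

def forestSet (n : ℕ) : Set (SimpleGraph (Fin n)) := {G | G.IsAcyclic}

/-- Expectation of `f` under the uniform distribution on the (finite) set `S` of graphs. -/
def unifExp {n : ℕ} (S : Set (SimpleGraph (Fin n))) (f : SimpleGraph (Fin n) → ℝ) : ℝ :=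
  (∑ᶠ G ∈ S, f G) / (Nat.card ↥S)

/-- Variance of `f` under the uniform distribution on `S`. -/
def unifVar {n : ℕ} (S : Set (SimpleGraph (Fin n))) (f : SimpleGraph (Fin n) → ℝ) : ℝ :=
  unifExp S (fun G => (f G - unifExp S f) ^ 2)

/-- Probability of the event `A` under the uniform distribution on `S`. -/
def unifPr {n : ℕ} (S A : Set (SimpleGraph (Fin n))) : ℝ :=
  (Nat.card ↥(S ∩ A) : ℝ) / (Nat.card ↥S)

/-- The probability weight of an individual graph in the Erdős–Rényi model `G(n,p)`. -/
def erWeight (n : ℕ) (p : ℝ) (G : SimpleGraph (Fin n)) : ℝ :=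
  p ^ (Nat.card ↥G.edgeSet) * (1 - p) ^ (n.choose 2 - Nat.card ↥G.edgeSet)

/-- Expectation of `f` in the Erdős–Rényi model `G(n,p)`. -/
def erExp (n : ℕ) (p : ℝ) (f : SimpleGraph (Fin n) → ℝ) : ℝ :=
  ∑ᶠ G : SimpleGraph (Fin n), erWeight n p G * f G

/-- Variance of `f` in the Erdős–Rényi model `G(n,p)`. -/
def erVar (n : ℕ) (p : ℝ) (f : SimpleGraph (Fin n) → ℝ) : ℝ :=
  erExp n p (fun G => (f G - erExp n p f) ^ 2)

/-- Probability of the event `A` in the Erdős–Rényi model `G(n,p)`. -/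
def erPr (n : ℕ) (p : ℝ) (A : Set (SimpleGraph (Fin n))) : ℝ :=
  ∑ᶠ G ∈ A, erWeight n p G

/-- The cumulative distribution function of the standard normal law. -/
def stdGaussianCDF (x : ℝ) : ℝ :=
  (Real.sqrt (2 * Real.pi))⁻¹ * ∫ t in Set.Iic x, Real.exp (-(t ^ 2) / 2)

/-- The normalized metric dimension `(β - E β)/sqrt (Var β)` for the uniform model on `S`. -/
def normβ {n : ℕ} (S : Set (SimpleGraph (Fin n))) (G : SimpleGraph (Fin n)) : ℝ :=
  (betaR G - unifExp S betaR) / Real.sqrt (unifVar S betaR)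

/-- The normalized metric dimension `(β - E β)/sqrt (Var β)` for the `G(n,p)` model. -/
def erNormβ (n : ℕ) (p : ℝ) (G : SimpleGraph (Fin n)) : ℝ :=
  (betaR G - erExp n p betaR) / Real.sqrt (erVar n p betaR)


/-- The number of connected components of `G` that are trees with exactly `k` vertices. -/
def treeCompCount {n : ℕ} (G : SimpleGraph (Fin n)) (k : ℕ) : ℕ :=
  Nat.card {C : G.ConnectedComponent // C.supp.ncard = k ∧ IsTree (G.induce C.supp)}

/-- The number of trees on the vertex set `V`. -/
def treeNum (V : Type*) : ℕ := Nat.card {T : SimpleGraph V // T.IsTree}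

/-- Attach every `b : B` as a pendant vertex to the vertex `f b` of a graph on `A`. -/
def attachLeaves {A B : Type*} (H : SimpleGraph A) (f : B → A) : SimpleGraph (A ⊕ B) where
  Adj
    | .inl a, .inl a' => H.Adj a a'
    | .inl a, .inr b => f b = a
    | .inr b, .inl a => f b = a
    | .inr _, .inr _ => False
  symm := ⟨by
    rintro (a | b) (a' | b') h
    · exact SimpleGraph.Adj.symm h
    · exact h
    · exact h
    · exact h⟩
  loopless := ⟨by
    rintro (a | b) h
    · exact H.loopless.irrefl a h
    · exact h⟩

section attachLeaves

variable {A B : Type*} (H : SimpleGraph A) (f : B → A)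

@[simp] lemma attachLeaves_inl_inl (a a' : A) :
    (attachLeaves H f).Adj (.inl a) (.inl a') ↔ H.Adj a a' := Iff.rfl

@[simp] lemma attachLeaves_inl_inr (a : A) (b : B) :
    (attachLeaves H f).Adj (.inl a) (.inr b) ↔ f b = a := Iff.rfl

@[simp] lemma attachLeaves_inr_inl (a : A) (b : B) :
    (attachLeaves H f).Adj (.inr b) (.inl a) ↔ f b = a := Iff.rfl

@[simp] lemma attachLeaves_inr_inr (b b' : B) :
    ¬ (attachLeaves H f).Adj (.inr b) (.inr b') := fun h => h

lemma card_edgeSet_attachLeaves [Finite A] [Finite B] :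
    Nat.card (attachLeaves H f).edgeSet = Nat.card H.edgeSet + Nat.card B := by
  rw [← Nat.card_sum]
  symm
  let φ : H.edgeSet ⊕ B → (attachLeaves H f).edgeSet := Sum.elim
    (fun e => ⟨Sym2.map Sum.inl e.1, by
      obtain ⟨e, he⟩ := e
      induction e with | _ a a' => simpa using he⟩)
    (fun b => ⟨s(.inl (f b), .inr b), by simp⟩)
  refine Nat.card_congr (Equiv.ofBijective φ ⟨?_, ?_⟩)
  · rintro (⟨e, he⟩ | b) (⟨e', he'⟩ | b') h
    · simp only [φ, Sum.elim_inl, Subtype.mk.injEq] at h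
      have := Sym2.map.injective Sum.inl_injective h
      simp [this]
    · induction e with | _ x y => simp [φ] at h
    · induction e' with | _ x y => simp [φ] at h
    · simp [φ] at h
      simp [h]
  · rintro ⟨e, he⟩
    induction e with | _ x y =>
    rcases x with a | b <;> rcases y with a' | b'
    · exact ⟨.inl ⟨s(a, a'), by simpa using he⟩, by simp [φ]⟩
    · exact ⟨.inr b', by simpa [φ] using he⟩
    · exact ⟨.inr b, by simpa [φ] using he⟩
    · simp at he

lemma reachable_of_attachLeaves {x y : A ⊕ B} (h : (attachLeaves H f).Reachable x y) :
    H.Reachable (Sum.elim id f x) (Sum.elim id f y) := by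
  obtain ⟨p⟩ := h
  induction p with
  | nil => exact .refl _
  | @cons u v w huv _ ih =>
    refine .trans ?_ ih
    rcases u with a | b <;> rcases v with a' | b'
    · exact SimpleGraph.Adj.reachable huv
    · have : f b' = a := huv
      simp [this]
    · have : f b = a' := huv
      simp [this]
    · exact huv.elim

lemma connected_attachLeaves : (attachLeaves H f).Connected ↔ H.Connected := by
  rw [SimpleGraph.connected_iff, SimpleGraph.connected_iff]
  refine and_congr ⟨fun h a a' => reachable_of_attachLeaves H f (h (.inl a) (.inl a')),
    fun h x y => ?_⟩ ⟨fun ⟨x⟩ => ⟨Sum.elim id f x⟩, fun ⟨a⟩ => ⟨.inl a⟩⟩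
  have key : ∀ x : A ⊕ B, (attachLeaves H f).Reachable x (.inl (Sum.elim id f x)) := by
    rintro (a | b)
    · exact .refl _
    · exact SimpleGraph.Adj.reachable rfl
  have hmap := (h (Sum.elim id f x) (Sum.elim id f y)).map
    (⟨Sum.inl, fun h => h⟩ : H →g attachLeaves H f)
  exact (key x).trans (hmap.trans (key y).symm)

lemma isTree_attachLeaves [Finite A] [Finite B] : (attachLeaves H f).IsTree ↔ H.IsTree := by
  rw [SimpleGraph.isTree_iff_connected_and_card, SimpleGraph.isTree_iff_connected_and_card,
    connected_attachLeaves, card_edgeSet_attachLeaves, Nat.card_sum]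
  refine and_congr_right fun _ => ?_
  omega

end attachLeaves

lemma not_adj_of_leaves {V : Type*} [Finite V] {T : SimpleGraph V} (hT : T.Connected)
    (hV : 3 ≤ Nat.card V) {u v : V} (hu : ∃! w, T.Adj u w) (hv : ∃! w, T.Adj v w) :
    ¬ T.Adj u v := by
  intro huv
  have key : ∀ x y, T.Reachable x y → (x = u ∨ x = v) → (y = u ∨ y = v) := by
    rintro x y ⟨p⟩
    induction p with
    | nil => exact id
    | cons h _ ih =>
      rintro (rfl | rfl)
      · exact ih (.inr (hu.unique h huv))
      · exact ih (.inl (hv.unique h huv.symm))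
  have hsub : (Set.univ : Set V) ⊆ {u, v} := fun y _ => key u y (hT.preconnected u y) (.inl rfl)
  have h1 := Set.ncard_le_ncard hsub
  have h2 := (Set.ncard_insert_le u {v}).trans_eq (by rw [Set.ncard_singleton])
  rw [Set.ncard_univ] at h1
  omega

lemma card_trees_with_leaves_sum {A B : Type*} [Finite A] [Finite B]
    (h3 : 3 ≤ Nat.card (A ⊕ B)) :
    Nat.card {T : SimpleGraph (A ⊕ B) // T.IsTree ∧ ∀ b : B, ∃! w, T.Adj (.inr b) w} =
      treeNum A * Nat.card A ^ Nat.card B := by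
  rw [treeNum, ← Nat.card_fun, ← Nat.card_prod]
  symm
  refine Nat.card_congr (Equiv.ofBijective (fun q => ⟨attachLeaves q.1.1 q.2,
    (isTree_attachLeaves _ _).2 q.1.2, fun b => ⟨.inl (q.2 b), rfl, ?_⟩⟩) ⟨?_, ?_⟩)
  · rintro (a | b') h
    · exact congrArg Sum.inl (show q.2 b = a from h).symm
    · exact h.elim
  · rintro ⟨⟨H, hH⟩, f⟩ ⟨⟨H', hH'⟩, f'⟩ h
    have h : attachLeaves H f = attachLeaves H' f' := congrArg Subtype.val h
    have hHH : H = H' := by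
      ext a a'
      rw [← attachLeaves_inl_inl H f, h, attachLeaves_inl_inl]
    have hff : f = f' := by
      ext b
      have : (attachLeaves H f).Adj (.inl (f b)) (.inr b) := rfl
      rw [h] at this
      exact ((attachLeaves_inl_inr H' f' _ _).1 this).symm
    subst hHH hff
    rfl
  · rintro ⟨T, hT, hl⟩
    have hno : ∀ b b', ¬ T.Adj (.inr b) (.inr b') := fun b b' =>
      not_adj_of_leaves hT.connected h3 (hl b) (hl b')
    have hf : ∀ b, ∃ a, T.Adj (.inr b) (.inl a) := by
      intro b
      obtain ⟨a | b', h, -⟩ := hl b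
      · exact ⟨a, h⟩
      · exact (hno _ _ h).elim
    choose f hf using hf
    have hiff : ∀ b a, f b = a ↔ T.Adj (.inr b) (.inl a) := fun b a =>
      ⟨fun h => h ▸ hf b, fun h => Sum.inl_injective ((hl b).unique (hf b) h)⟩
    have hTe : attachLeaves (T.comap Sum.inl) f = T := by
      ext x y
      rcases x with a | b <;> rcases y with a' | b'
      · rfl
      · exact (hiff b' a).trans (T.adj_comm _ _)
      · exact hiff b a'
      · exact iff_of_false id (hno b b')
    exact ⟨⟨⟨T.comap Sum.inl, (isTree_attachLeaves _ f).1 (by rwa [hTe])⟩, f⟩,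
      Subtype.ext hTe⟩

lemma treeNum_congr {V W : Type*} (e : V ≃ W) : treeNum V = treeNum W :=
  Nat.card_congr (e.simpleGraph.subtypeEquiv fun T =>
    (SimpleGraph.Iso.isTree_iff (SimpleGraph.Iso.comap e.symm T)).symm)

lemma card_trees_with_leaves {V : Type*} [Fintype V] (hV : 3 ≤ Fintype.card V) (J : Finset V) :
    Nat.card {T : SimpleGraph V // T.IsTree ∧ ∀ j ∈ J, ∃! w, T.Adj j w} =
      treeNum (Fin (Fintype.card V - J.card)) * (Fintype.card V - J.card) ^ J.card := by
  let e : {v // v ∉ J} ⊕ {v // v ∈ J} ≃ V := (Equiv.sumComm _ _).trans (Equiv.sumCompl (· ∈ J))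
  have hcompl : Nat.card {v // v ∉ J} = Fintype.card V - J.card := by
    rw [Nat.card_eq_fintype_card, Fintype.card_subtype_compl, Fintype.card_coe]
  have hJ : Nat.card {v // v ∈ J} = J.card := by simp
  have h3 : 3 ≤ Nat.card ({v // v ∉ J} ⊕ {v // v ∈ J}) := by
    rw [Nat.card_congr e, Nat.card_eq_fintype_card]
    exact hV
  have h := card_trees_with_leaves_sum h3
  rw [hcompl, hJ, treeNum_congr (Finite.equivFinOfCardEq hcompl)] at h
  rw [← h]
  refine Nat.card_congr (e.symm.simpleGraph.subtypeEquiv fun T => and_congr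
    (SimpleGraph.Iso.isTree_iff (SimpleGraph.Iso.comap e T)).symm ?_)
  have hb : ∀ b : {v // v ∈ J}, e (.inr b) = b := fun b => rfl
  constructor
  · intro hl b
    obtain ⟨w, hw, hu⟩ := hl b b.2
    refine ⟨e.symm w, by simpa [hb] using hw, fun y hy => ?_⟩
    rw [← hu (e y) (by simpa [hb] using hy), e.symm_apply_apply]
  · intro hl j hj
    obtain ⟨w, hw, hu⟩ := hl ⟨j, hj⟩
    refine ⟨e w, by simpa [hb] using hw, fun y hy => ?_⟩
    rw [← hu (e.symm y) (by simpa [hb] using hy), e.apply_symm_apply]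

lemma IsTree.exists_leaf {V : Type*} [Fintype V] [Nontrivial V] {T : SimpleGraph V}
    (hT : T.IsTree) : ∃ v, ∃! w, T.Adj v w := by
  obtain ⟨v, hv⟩ := hT.exists_vert_degree_one_of_nontrivial
  exact ⟨v, SimpleGraph.degree_eq_one_iff_existsUnique_adj.1 hv⟩

/-- Inclusion–exclusion over the set of leaves, which is nonempty for every tree. -/
lemma sum_neg_one_pow_card_trees_with_leaves {V : Type*} [Fintype V] [Nontrivial V] :
    ∑ J : Finset V, (-1 : ℤ) ^ J.card *
      Nat.card {T : SimpleGraph V // T.IsTree ∧ ∀ j ∈ J, ∃! w, T.Adj j w} = 0 := by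
  have h1 : ∀ J : Finset V,
      (Nat.card {T : SimpleGraph V // T.IsTree ∧ ∀ j ∈ J, ∃! w, T.Adj j w} : ℤ) =
        ∑ T : SimpleGraph V with T.IsTree,
          if J ⊆ Finset.univ.filter (fun v => ∃! w, T.Adj v w) then 1 else 0 := by
    intro J
    rw [Nat.card_eq_fintype_card, Fintype.card_subtype, Finset.sum_boole, Finset.filter_filter]
    congr 2
    ext T
    simp [Finset.subset_iff]
  simp_rw [h1, Finset.mul_sum]
  rw [Finset.sum_comm]
  refine Finset.sum_eq_zero fun T hT => ?_
  obtain ⟨v, hv⟩ := IsTree.exists_leaf (Finset.mem_filter.1 hT).2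
  simp_rw [mul_ite, mul_one, mul_zero]
  rw [← Finset.sum_filter]
  have : (Finset.univ.filter fun J : Finset V =>
      J ⊆ Finset.univ.filter (fun v => ∃! w, T.Adj v w)) =
      (Finset.univ.filter (fun v => ∃! w, T.Adj v w)).powerset := by
    ext J; simp
  rw [this]
  exact Finset.sum_powerset_neg_one_pow_card_of_nonempty ⟨v, by simpa using hv⟩

lemma treeNum_recurrence {n : ℕ} (hn : 3 ≤ n) :
    ∑ j ∈ Finset.range (n + 1), (-1 : ℤ) ^ j * n.choose j *
      (treeNum (Fin (n - j)) * ((n - j : ℕ) : ℤ) ^ j) = 0 := by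
  have : Nontrivial (Fin n) := Fin.nontrivial_iff_two_le.2 (by omega)
  have h := sum_neg_one_pow_card_trees_with_leaves (V := Fin n)
  simp_rw [card_trees_with_leaves (V := Fin n) (by simpa using hn), Fintype.card_fin] at h
  have h2 := Finset.sum_powerset_apply_card (fun j => (-1 : ℤ) ^ j *
    ((treeNum (Fin (n - j)) * (n - j) ^ j : ℕ) : ℤ)) (x := (Finset.univ : Finset (Fin n)))
  rw [Finset.powerset_univ, h, Finset.card_univ, Fintype.card_fin] at h2
  rw [h2]
  refine Finset.sum_congr rfl fun j _ => ?_
  rw [nsmul_eq_mul]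
  push_cast
  ring

lemma sum_neg_one_pow_choose_mul_pow {m n : ℕ} (h : m < n) :
    ∑ j ∈ Finset.range (n + 1), (-1 : ℤ) ^ j * n.choose j * ((n - j : ℕ) : ℤ) ^ m = 0 := by
  have h1 := congrFun (fwdDiff_iter_pow_eq_zero_of_lt (R := ℤ) h) 0
  rw [fwdDiff_iter_eq_sum_shift, ← Finset.sum_range_reflect] at h1
  refine Eq.trans ?_ h1
  refine Finset.sum_congr rfl fun j hj => ?_
  have hj' : j ≤ n := by simpa [Nat.lt_succ_iff] using hj
  have e : n + 1 - 1 - j = n - j := by omega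
  rw [e, Nat.choose_symm hj', Nat.sub_sub_self hj']
  simp

lemma treeNum_fin_one : treeNum (Fin 1) = 1 := by
  rw [treeNum, Nat.card_eq_one_iff_unique]
  exact ⟨⟨fun a b => Subsingleton.elim _ _⟩, ⟨⊥, SimpleGraph.IsTree.of_subsingleton⟩⟩

lemma treeNum_fin_two : treeNum (Fin 2) = 1 := by
  have htop : ∀ T : SimpleGraph (Fin 2), T.Connected → T = ⊤ := by
    intro T hT
    have h01 : T.Adj 0 1 := by
      obtain ⟨w, hw⟩ := hT.preconnected.exists_adj_of_nontrivial 0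
      have : w = 1 := by
        have := hw.ne
        omega
      exact this ▸ hw
    ext a b
    fin_cases a <;> fin_cases b <;> simp [h01, h01.symm]
  rw [treeNum, Nat.card_eq_one_iff_unique]
  refine ⟨⟨fun a b => Subtype.ext ?_⟩, ⟨⊤, SimpleGraph.connected_top, ?_⟩⟩
  · rw [htop _ a.2.connected, htop _ b.2.connected]
  · exact SimpleGraph.IsAcyclic.of_card_le_two (by simp)

/-- Cayley's formula. -/
theorem treeNum_fin {n : ℕ} (hn : 1 ≤ n) : treeNum (Fin n) = n ^ (n - 2) := by
  induction n using Nat.strong_induction_on with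
  | _ n ih =>
  obtain rfl | rfl | h3 : n = 1 ∨ n = 2 ∨ 3 ≤ n := by omega
  · simpa using treeNum_fin_one
  · simpa using treeNum_fin_two
  have h1 := treeNum_recurrence h3
  have h2 := sum_neg_one_pow_choose_mul_pow (show n - 2 < n by omega)
  rw [Finset.sum_range_succ'] at h1 h2
  have key : ∀ j ∈ Finset.range n, (-1 : ℤ) ^ (j + 1) * n.choose (j + 1) *
      (treeNum (Fin (n - (j + 1))) * ((n - (j + 1) : ℕ) : ℤ) ^ (j + 1)) =
      (-1 : ℤ) ^ (j + 1) * n.choose (j + 1) * ((n - (j + 1) : ℕ) : ℤ) ^ (n - 2) := by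
    intro j hj
    have hj := Finset.mem_range.1 hj
    congr 1
    obtain h | h | h : n - (j + 1) = 0 ∨ n - (j + 1) = 1 ∨ 2 ≤ n - (j + 1) := by omega
    · rw [h]
      simp [show n - 2 ≠ 0 by omega]
    · rw [h, treeNum_fin_one]
      simp
    · rw [ih _ (by omega) (by omega)]
      push_cast
      rw [← pow_add]
      congr 1
      omega
  rw [Finset.sum_congr rfl key] at h1
  have h3 := add_left_cancel (h1.trans h2.symm)
  simp only [pow_zero, Nat.choose_zero_right, Nat.cast_one, mul_one, one_mul, Nat.sub_zero] at h3
  exact_mod_cast h3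

/-- `S` is the vertex set of a connected component of `G` which is a tree. -/
def IsTreeComponent {V : Type*} (G : SimpleGraph V) (S : Finset V) : Prop :=
  (∀ u ∈ S, ∀ v, G.Adj u v → v ∈ S) ∧ (G.comap (Subtype.val : {v // v ∈ S} → V)).IsTree

lemma isTreeComponent_of_coe_eq_supp {V : Type*} {G : SimpleGraph V} {C : G.ConnectedComponent}
    {S : Finset V} (hS : (S : Set V) = C.supp) (hC : IsTree (G.induce C.supp)) :
    IsTreeComponent G S := by
  refine ⟨fun u hu v huv => ?_, ?_⟩
  · rw [← Finset.mem_coe, hS] at hu ⊢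
    exact C.mem_supp_of_adj_mem_supp hu huv
  · rw [← hS] at hC
    exact (SimpleGraph.isTree_iff _).2 hC

lemma IsTreeComponent.exists_supp {V : Type*} {G : SimpleGraph V} {S : Finset V}
    (h : IsTreeComponent G S) :
    ∃ C : G.ConnectedComponent, C.supp = S ∧ IsTree (G.induce C.supp) := by
  obtain ⟨hS, hT⟩ := h
  obtain ⟨v, hv⟩ := hT.connected.nonempty
  have hsupp : (G.connectedComponentMk v).supp = S := by
    ext w
    rw [SimpleGraph.ConnectedComponent.mem_supp_iff, SimpleGraph.ConnectedComponent.eq,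
      Finset.mem_coe]
    constructor
    · rintro hwv
      obtain ⟨p⟩ := hwv.symm
      clear hwv hT
      induction p with
      | nil => exact hv
      | cons h _ ih => exact ih (hS _ hv _ h)
    · intro hw
      exact (hT.connected.preconnected ⟨w, hw⟩ ⟨v, hv⟩).map
        (⟨Subtype.val, fun h => h⟩ : G.comap (Subtype.val : {v // v ∈ S} → V) →g G)
  refine ⟨_, hsupp, ?_⟩
  rw [hsupp]
  exact (SimpleGraph.isTree_iff _).1 hT

lemma treeCompCount_eq_card {n : ℕ} (G : SimpleGraph (Fin n)) (k : ℕ) :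
    treeCompCount G k =
      ((Finset.powersetCard k Finset.univ).filter (IsTreeComponent G)).card := by
  rw [treeCompCount, ← Fintype.card_coe, ← Nat.card_eq_fintype_card]
  have hcoe : ∀ C : G.ConnectedComponent,
      ((Finset.univ.filter (· ∈ C.supp) : Finset (Fin n)) : Set (Fin n)) = C.supp := by
    intro C
    ext v
    simp
  refine Nat.card_congr (Equiv.ofBijective
    (fun C => ⟨Finset.univ.filter (· ∈ C.1.supp), ?_⟩) ⟨?_, ?_⟩)
  · rw [Finset.mem_filter, Finset.mem_powersetCard]
    refine ⟨⟨Finset.subset_univ _, ?_⟩, isTreeComponent_of_coe_eq_supp (hcoe _) C.2.2⟩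
    rw [← Set.ncard_coe_finset, hcoe, C.2.1]
  · intro C D h
    have h := congrArg (fun S : Finset (Fin n) => (S : Set (Fin n))) (congrArg Subtype.val h)
    simp only [hcoe] at h
    exact Subtype.ext (SimpleGraph.ConnectedComponent.supp_injective h)
  · rintro ⟨S, hS⟩
    have hS' := hS
    rw [Finset.mem_filter, Finset.mem_powersetCard] at hS'
    obtain ⟨C, hC, hT⟩ := hS'.2.exists_supp
    refine ⟨⟨C, by rw [hC, Set.ncard_coe_finset, hS'.1.2], hT⟩, Subtype.ext ?_⟩
    exact Finset.coe_injective ((hcoe C).trans hC)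

lemma card_edgeSet_simpleGraph {V W : Type*} (e : V ≃ W) (G : SimpleGraph V) :
    Nat.card (e.simpleGraph G).edgeSet = Nat.card G.edgeSet :=
  Nat.card_congr (SimpleGraph.Iso.comap e.symm G).mapEdgeSet

lemma sum_isTreeComponent {V R : Type*} [Fintype V] [DecidableEq V] [AddCommMonoid R] (S : Finset V)
    (F : ℕ → R) :
    ∑ G : SimpleGraph V with IsTreeComponent G S, F (Nat.card G.edgeSet) =
      ∑ T : SimpleGraph {v // v ∈ S} with T.IsTree, ∑ H : SimpleGraph {v // v ∉ S},
        F (Nat.card T.edgeSet + Nat.card H.edgeSet) := by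
  let e : {v // v ∈ S} ⊕ {v // v ∉ S} ≃ V := Equiv.sumCompl (· ∈ S)
  have he : ∀ a : {v // v ∈ S}, e.symm a = .inl a := fun a => e.symm_apply_eq.2 rfl
  have he' : ∀ b : {v // v ∉ S}, e.symm b = .inr b := fun b => e.symm_apply_eq.2 rfl
  rw [← Finset.sum_product']
  symm
  refine Finset.sum_bij' (fun q _ => e.simpleGraph (q.1 ⊕g q.2))
    (fun G _ => (G.comap Subtype.val, G.comap Subtype.val)) ?_ ?_ ?_ ?_ ?_
  · rintro ⟨T, H⟩ hq
    simp only [Finset.mem_product, Finset.mem_filter, Finset.mem_univ, true_and, and_true] at hq ⊢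
    refine ⟨fun u hu v huv => ?_, ?_⟩
    · by_contra hv
      have h : (T ⊕g H).Adj (e.symm u) (e.symm v) := huv
      rw [he ⟨u, hu⟩, he' ⟨v, hv⟩] at h
      simp at h
    · convert hq using 1
      ext a a'
      change (T ⊕g H).Adj (e.symm a) (e.symm a') ↔ _
      rw [he, he, SimpleGraph.sum_adj_inl]
  · intro G hG
    simpa using (Finset.mem_filter.1 hG).2.2
  · rintro ⟨T, H⟩ -
    refine Prod.ext ?_ ?_
    · ext a a'
      change (T ⊕g H).Adj (e.symm a) (e.symm a') ↔ _
      rw [he, he, SimpleGraph.sum_adj_inl]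
    · ext a a'
      change (T ⊕g H).Adj (e.symm a) (e.symm a') ↔ _
      rw [he', he', SimpleGraph.sum_adj_inr]
  · intro G hG
    have hS := (Finset.mem_filter.1 hG).2.1
    ext u v
    change (SimpleGraph.comap _ G ⊕g SimpleGraph.comap _ G).Adj (e.symm u) (e.symm v) ↔ _
    by_cases hu : u ∈ S <;> by_cases hv : v ∈ S
    · rw [he ⟨u, hu⟩, he ⟨v, hv⟩, SimpleGraph.sum_adj_inl]
      rfl
    · rw [he ⟨u, hu⟩, he' ⟨v, hv⟩]
      simpa using fun h => hv (hS u hu v h)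
    · rw [he' ⟨u, hu⟩, he ⟨v, hv⟩]
      simpa using fun h : G.Adj u v => hu (hS v hv u h.symm)
    · rw [he' ⟨u, hu⟩, he' ⟨v, hv⟩, SimpleGraph.sum_adj_inr]
      rfl
  · rintro ⟨T, H⟩ -
    rw [card_edgeSet_simpleGraph, Nat.card_congr SimpleGraph.edgeSetSumEquiv, Nat.card_sum]

lemma card_edgeSet_le_choose_two {V : Type*} [Fintype V] (G : SimpleGraph V) :
    Nat.card G.edgeSet ≤ (Fintype.card V).choose 2 := by
  rw [Nat.card_eq_fintype_card, ← SimpleGraph.edgeFinset_card]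
  exact SimpleGraph.card_edgeFinset_le_card_choose_two

lemma sum_pow_card_edgeSet {V R : Type*} [Fintype V] [DecidableEq V] [CommSemiring R] (a b : R) :
    ∑ H : SimpleGraph V, a ^ Nat.card H.edgeSet *
      b ^ ((Fintype.card V).choose 2 - Nat.card H.edgeSet) =
      (a + b) ^ (Fintype.card V).choose 2 := by
  have h := Finset.sum_pow_mul_eq_add_pow a b (⊤ : SimpleGraph V).edgeFinset
  rw [SimpleGraph.card_edgeFinset_top_eq_card_choose_two] at h
  rw [← h]
  refine Finset.sum_bij' (fun H _ => H.edgeFinset)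
    (fun s _ => SimpleGraph.fromEdgeSet (s : Set (Sym2 V))) ?_ ?_ ?_ ?_ ?_
  · intro H _
    rw [Finset.mem_powerset, SimpleGraph.edgeFinset_subset_edgeFinset]
    exact le_top
  · simp
  · intro H _
    simp
  · intro s hs
    rw [Finset.mem_powerset] at hs
    ext e
    simp only [SimpleGraph.mem_edgeFinset, SimpleGraph.edgeSet_fromEdgeSet, Set.mem_sdiff, Finset.mem_coe, and_iff_left_iff_imp]
    intro he
    have := hs he
    rw [SimpleGraph.mem_edgeFinset] at this
    exact SimpleGraph.not_isDiag_of_mem_edgeSet _ this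
  · intro H _
    rw [SimpleGraph.edgeFinset_card, Nat.card_eq_fintype_card]

lemma add_choose_two (m k : ℕ) :
    (m + k).choose 2 = m.choose 2 + (k.choose 2 + m * k) := by
  induction k with
  | zero => simp
  | succ k ih =>
    rw [← add_assoc, Nat.choose_succ_succ' (m + k) 1, Nat.choose_succ_succ' k 1, ih]
    simp only [Nat.choose_one_right]
    ring

lemma sub_one_le_choose_two (k : ℕ) : k - 1 ≤ k.choose 2 := by
  cases k with
  | zero => simp
  | succ k =>
    rw [Nat.choose_succ_succ' k 1, Nat.choose_one_right]
    omega

/-- The probability that a given `k`-set spans a tree component of `G(n, p)`. -/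
lemma sum_erWeight_isTreeComponent {n k : ℕ} (p : ℝ) (hk : 1 ≤ k) (hkn : k ≤ n)
    {S : Finset (Fin n)} (hS : S.card = k) :
    ∑ G : SimpleGraph (Fin n) with IsTreeComponent G S, erWeight n p G =
      k ^ (k - 2) * (p ^ (k - 1) * (1 - p) ^ (k.choose 2 - (k - 1) + (n - k) * k)) := by
  have hA : Fintype.card {v // v ∈ S} = k := by rw [Fintype.card_coe, hS]
  have hB : Fintype.card {v // v ∉ S} = n - k := by
    rw [Fintype.card_subtype_compl, Fintype.card_coe, hS, Fintype.card_fin]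
  have hN : n.choose 2 = (n - k).choose 2 + (k.choose 2 + (n - k) * k) := by
    rw [← add_choose_two, Nat.sub_add_cancel hkn]
  have hk2 := sub_one_le_choose_two k
  have hsum := sum_pow_card_edgeSet (V := {v // v ∉ S}) p (1 - p)
  rw [hB, add_sub_cancel, one_pow] at hsum
  unfold erWeight
  rw [sum_isTreeComponent S (fun m => p ^ m * (1 - p) ^ (n.choose 2 - m))]
  have hin : ∀ T ∈ (Finset.univ : Finset (SimpleGraph {v // v ∈ S})).filter (·.IsTree),
      ∑ H : SimpleGraph {v // v ∉ S}, p ^ (Nat.card T.edgeSet + Nat.card H.edgeSet) *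
        (1 - p) ^ (n.choose 2 - (Nat.card T.edgeSet + Nat.card H.edgeSet)) =
      p ^ (k - 1) * (1 - p) ^ (k.choose 2 - (k - 1) + (n - k) * k) := by
    intro T hT
    have hT' := (SimpleGraph.isTree_iff_connected_and_card.1 (Finset.mem_filter.1 hT).2).2
    rw [Nat.card_eq_fintype_card (α := {v // v ∈ S}), hA] at hT'
    refine Eq.trans ?_ ((congrArg (_ * ·) hsum).trans (mul_one _))
    rw [Finset.mul_sum]
    refine Finset.sum_congr rfl fun H _ => ?_
    have hH := card_edgeSet_le_choose_two H
    rw [hB] at hH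
    have h1 : Nat.card T.edgeSet = k - 1 := by omega
    have h2 : n.choose 2 - (k - 1 + Nat.card H.edgeSet) =
      (k.choose 2 - (k - 1) + (n - k) * k) + ((n - k).choose 2 - Nat.card H.edgeSet) := by
      omega
    rw [h1, h2, pow_add, pow_add (1 - p)]
    ring
  rw [Finset.sum_congr rfl hin, Finset.sum_const, nsmul_eq_mul]
  congr 1
  rw [← Fintype.card_subtype, ← Nat.card_eq_fintype_card]
  change ((treeNum {v // v ∈ S} : ℕ) : ℝ) = _
  rw [treeNum_congr (Fintype.equivFinOfCardEq hA), treeNum_fin hk]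
  push_cast
  rfl

lemma erExp_treeCompCount {n k : ℕ} (p : ℝ) (hk : 1 ≤ k) (hkn : k ≤ n) :
    erExp n p (fun G => (treeCompCount G k : ℝ)) = n.choose k * (k ^ (k - 2) *
      (p ^ (k - 1) * (1 - p) ^ (k.choose 2 - (k - 1) + (n - k) * k))) := by
  rw [erExp, finsum_eq_sum_of_fintype]
  have h : ∀ G : SimpleGraph (Fin n), erWeight n p G * (treeCompCount G k : ℝ) =
      ∑ S ∈ Finset.powersetCard k (Finset.univ : Finset (Fin n)),
        if IsTreeComponent G S then erWeight n p G else 0 := by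
    intro G
    rw [treeCompCount_eq_card, ← Finset.sum_filter, Finset.sum_const, nsmul_eq_mul, mul_comm]
  simp_rw [h]
  rw [Finset.sum_comm]
  simp_rw [← Finset.sum_filter]
  rw [Finset.sum_congr rfl fun S hS =>
    sum_erWeight_isTreeComponent p hk hkn (Finset.mem_powersetCard.1 hS).2,
    Finset.sum_const, nsmul_eq_mul, Finset.card_powersetCard, Finset.card_univ, Fintype.card_fin]

/-- for `G_n ∈ G(n, c/n)` with `0 < c < 1` and fixed `k ≥ 2`,
`E[T_k(G_n)] = n·k^{k−2}·(c^{k−1}/k!)·e^{−kc}·(1+o(1))`. -/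
theorem er_tree_components (c : ℝ) (hc0 : 0 < c) (hc1 : c < 1) (k : ℕ) (hk : 2 ≤ k) :
    Tendsto (fun n : ℕ => erExp n (c / n) (fun G => (treeCompCount G k : ℝ)) / n) atTop
      (𝓝 ((k : ℝ) ^ (k - 2) * (c ^ (k - 1) / (Nat.factorial k)) * Real.exp (-(k : ℝ) * c))) := by
  have hp : Tendsto (fun n : ℕ => (n : ℝ) * (c / n)) atTop (𝓝 c) := by
    refine tendsto_const_nhds.congr' ?_
    filter_upwards [eventually_ge_atTop 1] with n hn
    field_simp
  have hchoose := ProbabilityTheory.tendsto_choose_mul_pow_atTop k hp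
  have hq : Tendsto (fun n : ℕ => 1 - c / n) atTop (𝓝 1) := by
    simpa using tendsto_const_nhds.sub (tendsto_const_div_atTop_nhds_zero_nat c)
  have hexp : Tendsto (fun n : ℕ => (1 - c / n) ^ n) atTop (𝓝 (Real.exp (-c))) := by
    refine (Real.tendsto_one_add_div_pow_exp (-c)).congr fun n => ?_
    rw [neg_div, ← sub_eq_add_neg]
  have hlim := (((hchoose.mul_const ((k : ℝ) ^ (k - 2) * c⁻¹)).mul
    (hq.pow (k.choose 2 - (k - 1)))).mul (hexp.pow k)).div (hq.pow (k * k)) (by simp)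
  have hval : c ^ k / (k.factorial : ℝ) * ((k : ℝ) ^ (k - 2) * c⁻¹) *
      1 ^ (k.choose 2 - (k - 1)) * Real.exp (-c) ^ k / 1 ^ (k * k) =
      (k : ℝ) ^ (k - 2) * (c ^ (k - 1) / (Nat.factorial k)) * Real.exp (-(k : ℝ) * c) := by
    rw [← Real.exp_nat_mul, ← Nat.sub_add_cancel (show 1 ≤ k by omega), pow_succ c,
      Nat.sub_add_cancel (show 1 ≤ k by omega), one_pow, one_pow, neg_mul, mul_neg]
    field_simp
  rw [hval] at hlim
  refine hlim.congr' ?_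
  filter_upwards [eventually_ge_atTop k, hq.eventually_ne one_ne_zero] with n hkn hn
  rw [erExp_treeCompCount _ (by omega) hkn]
  have hn0 : (n : ℝ) ≠ 0 := by
    rw [Nat.cast_ne_zero]
    omega
  have hck : (c / n) ^ k = (c / n) ^ (k - 1) * (c / n) := by
    rw [← pow_succ, Nat.sub_add_cancel (by omega)]
  have hpow : ((1 - c / n) ^ n) ^ k = (1 - c / n) ^ ((n - k) * k) * (1 - c / n) ^ (k * k) := by
    rw [← pow_mul, ← pow_add, ← add_mul, Nat.sub_add_cancel hkn]
  simp only [Pi.div_apply]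
  rw [hck, hpow, ← mul_assoc, mul_div_cancel_right₀ _ (pow_ne_zero _ hn), pow_add]
  generalize (1 - c / n) ^ ((n - k) * k) = x
  generalize (1 - c / n) ^ (k.choose 2 - (k - 1)) = y
  generalize (c / n) ^ (k - 1) = z
  field_simp

end MetricDimPaper
end
end

section
/- Fix 0 < c < 1 and let G_n ∈ G(n, c/n). Let R(G_n) denote the number of unordered pairs of distinct vertices of G_n that lie in the same connected component. Then E[R(G_n)] = O(n) as n → ∞. -/
open scoped Classical BigOperators
open Filter Topology

noncomputable section

namespace MetricDimPaper

/-- The number of unordered pairs of distinct vertices of `G` lying in the same connected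
component (2-element vertex sets whose elements are mutually reachable). -/
def samePairCount {n : ℕ} (G : SimpleGraph (Fin n)) : ℕ :=
  Nat.card {s : Finset (Fin n) // s.card = 2 ∧ ∀ u ∈ s, ∀ v ∈ s, G.Reachable u v}

theorem samePairCount_le_sum_reachable {n : ℕ} (G : SimpleGraph (Fin n)) :
    (samePairCount G : ℝ) ≤ ∑ u, ∑ v, if G.Reachable u v then (1 : ℝ) else 0 := by
  have hcard : samePairCount G ≤
      (Finset.univ.filter fun q : Fin n × Fin n => G.Reachable q.1 q.2).card := by
    rw [samePairCount, Nat.card_eq_fintype_card, Fintype.card_subtype]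
    refine (Finset.card_le_card (t := (Finset.univ.filter
      fun q : Fin n × Fin n => G.Reachable q.1 q.2).image fun q => {q.1, q.2}) ?_).trans
      Finset.card_image_le
    intro s hs
    obtain ⟨h2, hr⟩ := (Finset.mem_filter.1 hs).2
    obtain ⟨u, v, -, rfl⟩ := Finset.card_eq_two.1 h2
    exact Finset.mem_image.2 ⟨(u, v), by simpa using hr u (by simp) v (by simp), rfl⟩
  calc (samePairCount G : ℝ) ≤ _ := Nat.cast_le.2 hcard
    _ = _ := by rw [← Fintype.sum_prod_type', Finset.sum_boole]

theorem erWeight_nonneg {n : ℕ} {p : ℝ} (hp0 : 0 ≤ p) (hp1 : p ≤ 1)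
    (G : SimpleGraph (Fin n)) : 0 ≤ erWeight n p G :=
  mul_nonneg (pow_nonneg hp0 _) (pow_nonneg (sub_nonneg.2 hp1) _)

theorem sum_Icc_binomial_weight {α : Type*} [DecidableEq α] (p : ℝ) {T E : Finset α} (hTE : T ⊆ E) :
    ∑ S ∈ Finset.Icc T E, p ^ S.card * (1 - p) ^ (E.card - S.card) = p ^ T.card := by
  rw [Finset.Icc_eq_image_powerset hTE, Finset.sum_image]
  · have hone := Finset.sum_pow_mul_eq_add_pow p (1 - p) (E \ T)
    rw [add_sub_cancel, one_pow] at hone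
    refine Eq.trans ?_ ((congrArg (p ^ T.card * ·) hone).trans (mul_one _))
    simp only [Finset.mul_sum]
    refine Finset.sum_congr rfl fun S hS => ?_
    have hdisj : Disjoint T S :=
      Finset.disjoint_sdiff.mono_right (Finset.mem_powerset.1 hS)
    rw [Finset.card_union_of_disjoint hdisj, Finset.card_sdiff_of_subset hTE, pow_add,
      Nat.sub_add_eq, mul_assoc]
  · intro S hS S' hS' h
    have hd : Disjoint T S := Finset.disjoint_sdiff.mono_right (Finset.mem_powerset.1 hS)
    have hd' : Disjoint T S' := Finset.disjoint_sdiff.mono_right (Finset.mem_powerset.1 hS')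
    rw [← Finset.union_sdiff_cancel_left hd, ← Finset.union_sdiff_cancel_left hd']
    exact congrArg (· \ T) h

theorem sum_erWeight_of_subset_edgeSet_le {n : ℕ} {p : ℝ} (hp0 : 0 ≤ p) (hp1 : p ≤ 1)
    {T : Finset (Sym2 (Fin n))} (hT : T ⊆ (⊤ : SimpleGraph (Fin n)).edgeFinset) :
    ∑ G : SimpleGraph (Fin n), (if (T : Set (Sym2 (Fin n))) ⊆ G.edgeSet
      then erWeight n p G else 0) ≤ p ^ T.card := by
  rw [← Finset.sum_filter, ← sum_Icc_binomial_weight p hT]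
  have hE : (⊤ : SimpleGraph (Fin n)).edgeFinset.card = n.choose 2 := by
    simpa using SimpleGraph.card_edgeFinset_top_eq_card_choose_two (V := Fin n)
  have hw : ∀ G : SimpleGraph (Fin n), erWeight n p G =
      p ^ G.edgeFinset.card *
        (1 - p) ^ ((⊤ : SimpleGraph (Fin n)).edgeFinset.card - G.edgeFinset.card) := by
    intro G
    rw [erWeight, hE, Nat.card_eq_fintype_card, SimpleGraph.edgeFinset_card]
  have hinj : Function.Injective fun G : SimpleGraph (Fin n) => G.edgeFinset :=
    fun G H h => SimpleGraph.edgeFinset_inj.1 h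
  rw [Finset.sum_congr rfl fun G _ => hw G, ← Finset.sum_image
    (f := fun S : Finset (Sym2 (Fin n)) => p ^ S.card *
      (1 - p) ^ ((⊤ : SimpleGraph (Fin n)).edgeFinset.card - S.card))
    (g := fun G : SimpleGraph (Fin n) => G.edgeFinset) hinj.injOn]
  refine Finset.sum_le_sum_of_subset_of_nonneg ?_ fun S _ _ =>
    mul_nonneg (pow_nonneg hp0 _) (pow_nonneg (sub_nonneg.2 hp1) _)
  intro S hS
  obtain ⟨G, hG, rfl⟩ := Finset.mem_image.1 hS
  refine Finset.mem_Icc.2 ⟨?_, ?_⟩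
  · intro e he
    exact SimpleGraph.mem_edgeFinset.2 ((Finset.mem_filter.1 hG).2 he)
  · exact SimpleGraph.edgeFinset_mono le_top

theorem sum_card_finsetWalkLength_le {V : Type*} [Fintype V] [DecidableEq V] (G : SimpleGraph V)
    [DecidableRel G.Adj] (k : ℕ) (u : V) :
    ∑ v, (G.finsetWalkLength k u v).card ≤ Fintype.card V ^ k := by
  induction k generalizing u with
  | zero =>
    have h : ∀ v, (G.finsetWalkLength 0 u v).card = if u = v then 1 else 0 := by
      intro v
      by_cases h : u = v
      · subst h; simp [SimpleGraph.finsetWalkLength]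
      · simp [SimpleGraph.finsetWalkLength, h]
    simp [h]
  | succ k ih =>
    calc ∑ v, (G.finsetWalkLength (k + 1) u v).card
        ≤ ∑ v, ∑ w : G.neighborSet u, (G.finsetWalkLength k w v).card := by
          refine Finset.sum_le_sum fun v _ => ?_
          refine Finset.card_biUnion_le.trans (Finset.sum_le_sum fun w _ => ?_)
          rw [Finset.card_map]
      _ = ∑ w : G.neighborSet u, ∑ v, (G.finsetWalkLength k w v).card := Finset.sum_comm
      _ ≤ ∑ _w : G.neighborSet u, Fintype.card V ^ k := Finset.sum_le_sum fun w _ => ih w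
      _ ≤ Fintype.card V ^ (k + 1) := by
          rw [Finset.sum_const, smul_eq_mul, pow_succ', Finset.card_univ]
          exact Nat.mul_le_mul_right _ (Fintype.card_subtype_le _)

theorem reachable_indicator_le {n : ℕ} (G : SimpleGraph (Fin n)) (u v : Fin n) :
    (if G.Reachable u v then (1 : ℝ) else 0) ≤
      ∑ k ∈ Finset.range n,
        ∑ w ∈ ((⊤ : SimpleGraph (Fin n)).finsetWalkLength k u v).filter fun w => w.IsPath,
          if (w.edges.toFinset : Set (Sym2 (Fin n))) ⊆ G.edgeSet then (1 : ℝ) else 0 := by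
  have hnn : ∀ k ∈ Finset.range n, (0 : ℝ) ≤
        ∑ w ∈ ((⊤ : SimpleGraph (Fin n)).finsetWalkLength k u v).filter fun w => w.IsPath,
          if (w.edges.toFinset : Set (Sym2 (Fin n))) ⊆ G.edgeSet then (1 : ℝ) else 0 :=
    fun k _ => Finset.sum_nonneg fun w _ => by split_ifs <;> norm_num
  split_ifs with h
  · obtain ⟨q, hq⟩ := h.exists_isPath
    have hlen : q.length < n := by simpa using hq.length_lt
    refine le_trans ?_ (Finset.single_le_sum hnn (Finset.mem_range.2 hlen))
    have hmem : q.mapLe le_top ∈ ((⊤ : SimpleGraph (Fin n)).finsetWalkLength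
        q.length u v).filter fun w => w.IsPath := by
      refine Finset.mem_filter.2 ⟨?_, hq.mapLe le_top⟩
      rw [SimpleGraph.mem_finsetWalkLength_iff]
      simp [SimpleGraph.Walk.mapLe]
    refine le_trans ?_ (Finset.single_le_sum (fun w _ => ?_) hmem)
    · rw [if_pos]
      intro e he
      have he' : e ∈ q.edges := by simpa using he
      exact q.edges_subset_edgeSet he'
    · split_ifs <;> norm_num
  · exact Finset.sum_nonneg hnn

theorem erExp_samePairCount_le {n : ℕ} {p : ℝ} (hp0 : 0 ≤ p) (hp1 : p ≤ 1) :
    erExp n p (fun G => (samePairCount G : ℝ)) ≤ n * ∑ k ∈ Finset.range n, (n * p) ^ k := by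
  set P : ℕ → (u v : Fin n) → Finset ((⊤ : SimpleGraph (Fin n)).Walk u v) := fun k u v =>
    ((⊤ : SimpleGraph (Fin n)).finsetWalkLength k u v).filter fun w => w.IsPath with hP
  have hpath : ∀ k u v, ∀ w ∈ P k u v,
      ∑ G : SimpleGraph (Fin n), erWeight n p G *
        (if (w.edges.toFinset : Set (Sym2 (Fin n))) ⊆ G.edgeSet then (1 : ℝ) else 0)
        ≤ p ^ k := by
    intro k u v w hw
    obtain ⟨hk, hwp⟩ := Finset.mem_filter.1 hw
    rw [SimpleGraph.mem_finsetWalkLength_iff] at hk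
    have hcard : w.edges.toFinset.card = k := by
      rw [List.toFinset_card_of_nodup hwp.isTrail.edges_nodup, SimpleGraph.Walk.length_edges, hk]
    rw [← hcard]
    simp only [mul_ite, mul_one, mul_zero]
    refine sum_erWeight_of_subset_edgeSet_le hp0 hp1 fun e he => ?_
    exact SimpleGraph.mem_edgeFinset.2 (w.edges_subset_edgeSet (List.mem_toFinset.1 he))
  rw [erExp, finsum_eq_sum_of_fintype]
  calc ∑ G : SimpleGraph (Fin n), erWeight n p G * (samePairCount G : ℝ)
      ≤ ∑ G : SimpleGraph (Fin n), erWeight n p G * ∑ u, ∑ v, ∑ k ∈ Finset.range n,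
          ∑ w ∈ P k u v,
            if (w.edges.toFinset : Set (Sym2 (Fin n))) ⊆ G.edgeSet then (1 : ℝ) else 0 := by
        refine Finset.sum_le_sum fun G _ =>
          mul_le_mul_of_nonneg_left ?_ (erWeight_nonneg hp0 hp1 G)
        exact (samePairCount_le_sum_reachable G).trans (Finset.sum_le_sum fun u _ =>
          Finset.sum_le_sum fun v _ => reachable_indicator_le G u v)
    _ = ∑ u, ∑ v, ∑ k ∈ Finset.range n, ∑ w ∈ P k u v,
          ∑ G : SimpleGraph (Fin n), erWeight n p G *
            (if (w.edges.toFinset : Set (Sym2 (Fin n))) ⊆ G.edgeSet then (1 : ℝ) else 0) := by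
        simp only [Finset.mul_sum]
        rw [Finset.sum_comm]
        refine Finset.sum_congr rfl fun u _ => ?_
        rw [Finset.sum_comm]
        refine Finset.sum_congr rfl fun v _ => ?_
        rw [Finset.sum_comm]
        exact Finset.sum_congr rfl fun k _ => Finset.sum_comm
    _ ≤ ∑ u : Fin n, ∑ v : Fin n, ∑ k ∈ Finset.range n,
          (((⊤ : SimpleGraph (Fin n)).finsetWalkLength k u v).card : ℝ) * p ^ k := by
        refine Finset.sum_le_sum fun u _ => Finset.sum_le_sum fun v _ =>
          Finset.sum_le_sum fun k _ => ?_
        refine (Finset.sum_le_card_nsmul _ _ _ (hpath k u v)).trans ?_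
        rw [nsmul_eq_mul]
        exact mul_le_mul_of_nonneg_right
          (Nat.cast_le.2 (Finset.card_filter_le _ _)) (pow_nonneg hp0 _)
    _ = ∑ u : Fin n, ∑ k ∈ Finset.range n,
          ((∑ v, ((⊤ : SimpleGraph (Fin n)).finsetWalkLength k u v).card : ℕ) : ℝ) * p ^ k := by
        refine Finset.sum_congr rfl fun u _ => ?_
        rw [Finset.sum_comm]
        simp only [Nat.cast_sum, Finset.sum_mul]
    _ ≤ ∑ _u : Fin n, ∑ k ∈ Finset.range n, (n * p) ^ k := by
        refine Finset.sum_le_sum fun u _ => Finset.sum_le_sum fun k _ => ?_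
        rw [mul_pow]
        refine mul_le_mul_of_nonneg_right ?_ (pow_nonneg hp0 _)
        exact_mod_cast (sum_card_finsetWalkLength_le (⊤ : SimpleGraph (Fin n)) k u).trans_eq
          (by rw [Fintype.card_fin])
    _ = n * ∑ k ∈ Finset.range n, (n * p) ^ k := by simp

/-- for `G_n ∈ G(n, c/n)` with `0 < c < 1`, `E[R(G_n)] = O(n)`. -/
theorem er_same_component_pairs (c : ℝ) (hc0 : 0 < c) (hc1 : c < 1) :
    ∃ C : ℝ, 0 < C ∧ ∃ N : ℕ, ∀ n : ℕ, N ≤ n →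
      |erExp n (c / n) (fun G => (samePairCount G : ℝ))| ≤ C * n := by
  refine ⟨(1 - c)⁻¹, inv_pos.2 (sub_pos.2 hc1), 1, fun n hn => ?_⟩
  have hn1 : (1 : ℝ) ≤ n := by exact_mod_cast hn
  have hn0 : (0 : ℝ) < n := by linarith
  have hp0 : 0 ≤ c / n := by positivity
  have hp1 : c / n ≤ 1 := (div_le_one hn0).2 (by linarith)
  have hnonneg : 0 ≤ erExp n (c / n) (fun G => (samePairCount G : ℝ)) := by
    rw [erExp, finsum_eq_sum_of_fintype]
    exact Finset.sum_nonneg fun G _ =>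
      mul_nonneg (erWeight_nonneg hp0 hp1 G) (Nat.cast_nonneg _)
  rw [abs_of_nonneg hnonneg]
  refine (erExp_samePairCount_le hp0 hp1).trans ?_
  rw [mul_div_cancel₀ c hn0.ne', mul_comm]
  refine mul_le_mul_of_nonneg_right ?_ hn0.le
  rw [← tsum_geometric_of_lt_one hc0.le hc1]
  exact (summable_geometric_of_lt_one hc0.le hc1).sum_le_tsum _
    fun k _ => pow_nonneg hc0.le k

end MetricDimPaper
end
end

section
/- Let G be a finite simple graph with connected components G_1, …, G_k, where k ≥ 2. If none of the components is an isolated vertex, then β(G) = Σ_{i=1}^k β(G_i). If at least one component is an isolated vertex, then β(G) = (Σ_{i=1}^k β(G_i)) − 1. -/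
open scoped Classical BigOperators
open Filter Topology

noncomputable section

namespace MetricDimPaper

theorem edist_induce_supp {V : Type*} {G : SimpleGraph V} (C : G.ConnectedComponent)
    (u v : C.supp) : (G.induce C.supp).edist u v = G.edist (u : V) v := by
  have lift : ∀ {a b : V} (p : G.Walk a b) (ha : a ∈ C.supp) (hb : b ∈ C.supp),
      ∃ q : (G.induce C.supp).Walk ⟨a, ha⟩ ⟨b, hb⟩, q.length = p.length := by
    intro a b p
    induction p with
    | nil => exact fun _ _ => ⟨.nil, rfl⟩
    | @cons a c b h p ih =>
      intro ha hb
      have hc : c ∈ C.supp := C.mem_supp_of_adj_mem_supp ha h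
      obtain ⟨q, hq⟩ := ih hc hb
      have h' : (G.induce C.supp).Adj ⟨a, ha⟩ ⟨c, hc⟩ := h
      exact ⟨.cons h' q, by simp [hq]⟩
  apply le_antisymm
  · by_cases htop : G.edist (u : V) v = ⊤
    · simp [htop]
    · obtain ⟨p, hp⟩ := SimpleGraph.exists_walk_of_edist_ne_top htop
      obtain ⟨q, hq⟩ := lift p u.2 v.2
      rw [← hp, ← hq]
      exact SimpleGraph.edist_le q
  · by_cases htop : (G.induce C.supp).edist u v = ⊤
    · simp [htop]
    · obtain ⟨p, hp⟩ := SimpleGraph.exists_walk_of_edist_ne_top htop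
      rw [← hp, ← SimpleGraph.Walk.length_map (SimpleGraph.Embedding.induce C.supp).toHom p]
      exact SimpleGraph.edist_le _

theorem edist_eq_top_of_mem_supp {V : Type*} {G : SimpleGraph V} {C : G.ConnectedComponent}
    {u w : V} (hu : u ∉ C.supp) (hw : w ∈ C.supp) : G.edist u w = ⊤ := by
  apply SimpleGraph.edist_eq_top_of_not_reachable
  intro h
  rw [SimpleGraph.ConnectedComponent.mem_supp_iff] at hu hw
  exact hu ((SimpleGraph.ConnectedComponent.eq.2 h).trans hw)

theorem edist_ne_top_of_mem_supp {V : Type*} {G : SimpleGraph V} {C : G.ConnectedComponent}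
    {u w : V} (hu : u ∈ C.supp) (hw : w ∈ C.supp) : G.edist u w ≠ ⊤ := by
  rw [SimpleGraph.edist_ne_top_iff_reachable]
  exact C.reachable_of_mem_supp hu hw

theorem Resolves.induce_supp {V : Type*} {G : SimpleGraph V} {R : Set V} (h : Resolves G R)
    (C : G.ConnectedComponent) :
    Resolves (G.induce C.supp) ((↑) ⁻¹' R) := by
  intro u v huv
  obtain ⟨w, hw, hne⟩ := h u v (Subtype.coe_ne_coe.2 huv)
  by_cases hwC : w ∈ C.supp
  · refine ⟨⟨w, hwC⟩, hw, ?_⟩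
    rwa [edist_induce_supp, edist_induce_supp]
  · refine absurd ?_ hne
    rw [SimpleGraph.edist_comm, edist_eq_top_of_mem_supp hwC u.2, SimpleGraph.edist_comm,
      edist_eq_top_of_mem_supp hwC v.2]

theorem Resolves.nonempty_or_nonempty {V : Type*} {G : SimpleGraph V} {R : Set V}
    (h : Resolves G R) {C D : G.ConnectedComponent} (hCD : C ≠ D) :
    ((↑) ⁻¹' R : Set C.supp).Nonempty ∨ ((↑) ⁻¹' R : Set D.supp).Nonempty := by
  obtain ⟨u, hu⟩ := C.nonempty_supp
  obtain ⟨v, hv⟩ := D.nonempty_supp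
  have huv : u ≠ v := by
    rintro rfl
    exact hCD (hu.symm.trans hv)
  obtain ⟨w, hw, hne⟩ := h u v huv
  by_cases hwC : w ∈ C.supp
  · exact .inl ⟨⟨w, hwC⟩, hw⟩
  by_cases hwD : w ∈ D.supp
  · exact .inr ⟨⟨w, hwD⟩, hw⟩
  refine absurd ?_ hne
  rw [SimpleGraph.edist_comm, edist_eq_top_of_mem_supp hwC hu, SimpleGraph.edist_comm,
    edist_eq_top_of_mem_supp hwD hv]

theorem resolves_of_induce_supp {V : Type*} {G : SimpleGraph V} {R : Set V}
    (h : ∀ C : G.ConnectedComponent, Resolves (G.induce C.supp) ((↑) ⁻¹' R))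
    (hne : ∀ C D : G.ConnectedComponent, C ≠ D →
      ((↑) ⁻¹' R : Set C.supp).Nonempty ∨ ((↑) ⁻¹' R : Set D.supp).Nonempty) :
    Resolves G R := by
  intro u v huv
  by_cases hC : G.connectedComponentMk u = G.connectedComponentMk v
  · obtain ⟨w, hw, hd⟩ := h (G.connectedComponentMk v) ⟨u, hC⟩ ⟨v, rfl⟩
      (fun h => huv (congrArg Subtype.val h))
    rw [edist_induce_supp, edist_induce_supp] at hd
    exact ⟨w, hw, hd⟩
  · have hu : u ∉ (G.connectedComponentMk v).supp := hC
    have hv : v ∉ (G.connectedComponentMk u).supp := fun h => hC h.symm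
    rcases hne _ _ hC with ⟨w, hw⟩ | ⟨w, hw⟩
    · refine ⟨w, hw, ?_⟩
      rw [edist_eq_top_of_mem_supp hv w.2]
      exact edist_ne_top_of_mem_supp rfl w.2
    · refine ⟨w, hw, ?_⟩
      rw [edist_eq_top_of_mem_supp hu w.2]
      exact (edist_ne_top_of_mem_supp rfl w.2).symm

theorem ncard_eq_sum_components {V : Type*} [Finite V] (G : SimpleGraph V)
    [Fintype G.ConnectedComponent] (R : Set V) :
    R.ncard = ∑ C : G.ConnectedComponent, ((↑) ⁻¹' R : Set C.supp).ncard := by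
  have := Fintype.ofFinite V
  rw [Set.ncard_eq_toFinset_card',
    Finset.card_eq_sum_card_fiberwise (f := G.connectedComponentMk) (t := Finset.univ) (by simp)]
  refine Finset.sum_congr rfl fun C _ => ?_
  rw [← Set.ncard_image_of_injective _ Subtype.val_injective, ← Set.ncard_coe_finset]
  congr 1
  ext v
  simp [and_comm]

theorem resolves_univ {V : Type*} (G : SimpleGraph V) : Resolves G Set.univ := fun u v huv =>
  ⟨u, trivial, by simpa using (SimpleGraph.edist_pos_of_ne huv.symm).ne⟩

theorem Resolves.nonempty {V : Type*} [Nonempty V] [Finite V] {G : SimpleGraph V} {R : Set V}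
    (h : Resolves G R) (hV : Nat.card V ≠ 1) : R.Nonempty := by
  have : Nontrivial V := by
    rw [← Finite.one_lt_card_iff_nontrivial]
    have := Nat.card_pos (α := V)
    omega
  obtain ⟨u, v, huv⟩ := exists_pair_ne V
  obtain ⟨w, hw, -⟩ := h u v huv
  exact ⟨w, hw⟩

theorem metricDim_le {V : Type*} [Finite V] {G : SimpleGraph V} {R : Set V}
    (h : Resolves G R) (hR : R.Nonempty) : metricDim G ≤ R.ncard := by
  unfold metricDim
  split_ifs with hV
  · exact (Set.ncard_pos).2 hR
  · exact Nat.sInf_le ⟨R, rfl, h⟩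

theorem exists_resolves_ncard_eq_metricDim {V : Type*} [Finite V] [Nonempty V]
    (G : SimpleGraph V) : ∃ R : Set V, R.Nonempty ∧ Resolves G R ∧ R.ncard = metricDim G := by
  by_cases hV : Nat.card V = 1
  · exact ⟨Set.univ, Set.univ_nonempty, resolves_univ G, by simp [metricDim, hV, Set.ncard_univ]⟩
  · obtain ⟨R, hR, h⟩ : metricDim G ∈ {m : ℕ | ∃ R : Set V, R.ncard = m ∧ Resolves G R} := by
      rw [metricDim, if_neg hV]
      exact Nat.sInf_mem ⟨_, Set.univ, rfl, resolves_univ G⟩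
    exact ⟨R, h.nonempty hV, h, hR⟩

/-- Resolving sets of the components, at most one of them empty, have a resolving union. -/
theorem metricDim_le_sum {V : Type*} [Finite V] {G : SimpleGraph V}
    [Fintype G.ConnectedComponent] (hk : 2 ≤ Nat.card G.ConnectedComponent)
    (S : ∀ C : G.ConnectedComponent, Set C.supp)
    (h : ∀ C, Resolves (G.induce C.supp) (S C))
    (hne : ∀ C D, C ≠ D → (S C).Nonempty ∨ (S D).Nonempty) :
    metricDim G ≤ ∑ C, (S C).ncard := by
  let R : Set V := {v | (⟨v, rfl⟩ : (G.connectedComponentMk v).supp) ∈ S _}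
  have hR : ∀ C : G.ConnectedComponent, ((↑) ⁻¹' R : Set C.supp) = S C := by
    intro C
    ext ⟨v, hv⟩
    obtain rfl : G.connectedComponentMk v = C := hv
    rfl
  have hres : Resolves G R := resolves_of_induce_supp (fun C => by rw [hR]; exact h C)
    (fun C D hCD => by rw [hR, hR]; exact hne C D hCD)
  have : Nontrivial G.ConnectedComponent := Finite.one_lt_card_iff_nontrivial.1 hk
  obtain ⟨C, D, hCD⟩ := exists_pair_ne G.ConnectedComponent
  have hRne : R.Nonempty := by
    rcases hres.nonempty_or_nonempty hCD with ⟨w, hw⟩ | ⟨w, hw⟩ <;> exact ⟨w, hw⟩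
  refine (metricDim_le hres hRne).trans_eq ?_
  rw [ncard_eq_sum_components G R]
  exact Finset.sum_congr rfl fun C _ => by rw [hR]

/-- for a finite simple graph with `k ≥ 2` connected components, the metric
dimension is the sum of the metric dimensions of the components if no component is an
isolated vertex, and that sum minus one if some component is an isolated vertex. -/
theorem metricDim_components {V : Type*} [Finite V] (G : SimpleGraph V)
    (hk : 2 ≤ Nat.card G.ConnectedComponent) :
    ((∀ C : G.ConnectedComponent, C.supp.ncard ≠ 1) →
      metricDim G = ∑ᶠ C : G.ConnectedComponent, metricDim (G.induce C.supp)) ∧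
    ((∃ C : G.ConnectedComponent, C.supp.ncard = 1) →
      metricDim G = (∑ᶠ C : G.ConnectedComponent, metricDim (G.induce C.supp)) - 1) := by
  have := Fintype.ofFinite G.ConnectedComponent
  have hsupp : ∀ C : G.ConnectedComponent, Nonempty C.supp := fun C => C.nonempty_supp.to_subtype
  have : Nonempty V := by
    have : Nonempty G.ConnectedComponent := (Nat.card_pos_iff.1 (by omega)).1
    obtain ⟨v, -⟩ := (Classical.arbitrary G.ConnectedComponent).nonempty_supp
    exact ⟨v⟩
  rw [finsum_eq_sum_of_fintype]
  choose S hSne hS hScard using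
    fun C : G.ConnectedComponent => exists_resolves_ncard_eq_metricDim (G.induce C.supp)
  obtain ⟨R, -, hR, hRcard⟩ := exists_resolves_ncard_eq_metricDim G
  have hRsum := ncard_eq_sum_components G R
  constructor
  · intro hiso
    apply le_antisymm
    · simpa only [hScard] using metricDim_le_sum hk S hS fun C _ _ => .inl (hSne C)
    · rw [← hRcard, hRsum]
      exact Finset.sum_le_sum fun C _ =>
        metricDim_le (hR.induce_supp C) ((hR.induce_supp C).nonempty (hiso C))
  · rintro ⟨C₀, hC₀⟩
    have hone : ∀ C : G.ConnectedComponent, Nat.card C.supp = 1 →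
        metricDim (G.induce C.supp) = 1 := fun C hC => if_pos hC
    have hupper : metricDim G + 1 ≤ ∑ C : G.ConnectedComponent, metricDim (G.induce C.supp) := by
      have h := metricDim_le_sum hk (Function.update S C₀ ∅)
        (fun C => by
          by_cases hC : C = C₀
          · subst hC
            have : Subsingleton C.supp := (Nat.card_eq_one_iff_unique.1 hC₀).1
            exact fun u v huv => absurd (Subsingleton.elim u v) huv
          · rw [Function.update_of_ne hC]
            exact hS C)
        (fun C D hCD => by
          by_cases hC : C = C₀
          · right
            rw [Function.update_of_ne (hC ▸ hCD.symm)]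
            exact hSne D
          · left
            rw [Function.update_of_ne hC]
            exact hSne C)
      rw [← Finset.add_sum_erase _ _ (Finset.mem_univ C₀)] at h ⊢
      rw [Function.update_self, Set.ncard_empty, Finset.sum_congr rfl fun C hC => by
        rw [Function.update_of_ne (Finset.ne_of_mem_erase hC), hScard]] at h
      have := hone C₀ hC₀
      omega
    have hlower : ∑ C : G.ConnectedComponent, metricDim (G.induce C.supp) ≤ metricDim G + 1 := by
      rw [← hRcard, hRsum]
      by_cases hall : ∀ C : G.ConnectedComponent, ((↑) ⁻¹' R : Set C.supp).Nonempty
      · exact (Finset.sum_le_sum fun C _ => metricDim_le (hR.induce_supp C) (hall C)).trans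
          (Nat.le_succ _)
      · obtain ⟨C₁, hC₁⟩ := not_forall.1 hall
        have hcard := hone C₁ (not_not.1 fun h => hC₁ ((hR.induce_supp C₁).nonempty h))
        rw [← Finset.add_sum_erase _ _ (Finset.mem_univ C₁), hcard, add_comm]
        gcongr
        refine (Finset.sum_le_sum fun C hC => metricDim_le (hR.induce_supp C) ?_).trans
          (Finset.sum_le_sum_of_subset (Finset.erase_subset _ _))
        exact (hR.nonempty_or_nonempty (Finset.ne_of_mem_erase hC)).resolve_right hC₁
    omega

end MetricDimPaper
end
end
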